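/- arXiv:0705.1220 — 2 statements merged into one kernel-verified Lean document; each statement's English description precedes it below -/
import Mathlib

section
/- (Pelc, odd case) Let n ≥ 3 be an odd natural number. Then the least natural number q with W q n 0 equals the least natural number q satisfying n · (q + 1) + q ≤ 2^q + 1 (i.e., n ≤ (2^q − q + 1)/(q + 1)). -/
/-- `W j a b` : the questioner can force a win within `j` questions from
state `(a, b)` (a = candidates fitting all answers, b = candidates fitting
all but exactly one answer) in Ulam's liar game with one lie. -/
def W : ℕ → ℕ → ℕ → Prop
  | 0, a, b => a + b ≤ 1
  | (j+1), a, b => ∃ a₁ a₂ b₁ b₂ : ℕ, a₁ + a₂ = a ∧ b₁ + b₂ = b ∧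
      W j a₁ (b₁ + a₂) ∧ W j a₂ (b₂ + a₁)

/-- The volume bound: a winning state `(a, b)` with `j` questions left satisfies
`a * (j + 1) + b ≤ 2 ^ j`. -/
theorem W.volume_le {j a b : ℕ} (h : W j a b) : a * (j + 1) + b ≤ 2 ^ j := by
  induction j generalizing a b with
  | zero => simpa [W] using h
  | succ j ih =>
    obtain ⟨a₁, a₂, b₁, b₂, rfl, rfl, h₁, h₂⟩ := h
    have h₁ := ih h₁
    have h₂ := ih h₂
    rw [pow_succ]
    linarith

theorem sq_add_three_mul_le_two_pow_succ {j : ℕ} (hj : 4 ≤ j) :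
    j * j + 3 * j ≤ 2 * 2 ^ j := by
  induction j, hj using Nat.le_induction with
  | base => norm_num
  | succ j hj ih =>
    rw [pow_succ]
    nlinarith

/-- For states with `a ≤ b + 1` the volume bound is also sufficient for winning. -/
theorem W_of_volume_le {j a b : ℕ} (hab : a ≤ b + 1) (h : a * (j + 1) + b ≤ 2 ^ j) :
    W j a b := by
  induction j generalizing a b with
  | zero => simpa [W] using h
  | succ j ih =>
    rw [pow_succ] at h
    obtain ⟨k, rfl | rfl⟩ := Nat.even_or_odd' a
    · refine ⟨k, k, b / 2, b - b / 2, by ring, by omega, ih (by omega) ?_, ih (by omega) ?_⟩ <;>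
      · ring_nf at h ⊢
        omega
    · rcases le_or_gt j b with hjb | hjb
      · refine ⟨k + 1, k, (b - j) / 2, b - (b - j) / 2, by ring, by omega,
          ih (by omega) ?_, ih (by omega) ?_⟩ <;>
        · ring_nf at h ⊢
          omega
      · have key : (k + 1) * (j + 1) + k ≤ 2 ^ j := by
          rcases le_or_gt 4 j with hj | hj
          · have := sq_add_three_mul_le_two_pow_succ hj
            nlinarith
          · have hk : k ≤ 1 := by omega
            interval_cases j <;> interval_cases k <;> omega
        refine ⟨k + 1, k, 0, b, by ring, by omega, ih (by omega) (by omega), ih (by omega) ?_⟩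
        linarith

theorem W_odd_iff {n : ℕ} (hn : 3 ≤ n) (hodd : Odd n) (q : ℕ) :
    W q n 0 ↔ n * (q + 1) + q ≤ 2 ^ q + 1 := by
  obtain ⟨m, rfl⟩ := hodd
  cases q with
  | zero => simp only [W]; omega
  | succ j =>
    rw [pow_succ]
    constructor
    · rintro ⟨a₁, a₂, b₁, b₂, ha, hb, h₁, h₂⟩
      have h₁ := h₁.volume_le
      have h₂ := h₂.volume_le
      rcases le_or_gt a₁ m with h | h
      · obtain ⟨c, rfl⟩ : ∃ c, a₂ = m + 1 + c := ⟨a₂ - (m + 1), by omega⟩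
        nlinarith [Nat.zero_le (c * j)]
      · obtain ⟨c, rfl⟩ : ∃ c, a₁ = m + 1 + c := ⟨a₁ - (m + 1), by omega⟩
        nlinarith [Nat.zero_le (c * j)]
    · intro h
      refine ⟨m + 1, m, 0, 0, by ring, rfl, W_of_volume_le (by omega) ?_,
        W_of_volume_le (by omega) ?_⟩ <;> linarith

theorem pelc_odd (n : ℕ) (hn : 3 ≤ n) (hodd : Odd n) :
    sInf {q : ℕ | W q n 0} = sInf {q : ℕ | n * (q + 1) + q ≤ 2 ^ q + 1} := by
  simp only [W_odd_iff hn hodd]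
end

section
/- (Answer to Ulam's question) W 25 (10^6) 0 and ¬ W 24 (10^6) 0; that is, q₁(10^6) = 25: twenty-five questions suffice and are necessary to determine an integer between 1 and 10^6 when one untruthful answer is allowed. -/
theorem W.mono {j a b a' b' : ℕ} (h : W j a b) (ha : a' ≤ a) (hb : b' ≤ b) : W j a' b' := by
  induction j generalizing a b a' b' with
  | zero => simp only [W] at h ⊢; omega
  | succ j ih =>
    obtain ⟨a₁, a₂, b₁, b₂, rfl, rfl, h₁, h₂⟩ := h
    exact ⟨min a₁ a', a' - min a₁ a', min b₁ b', b' - min b₁ b', by omega, by omega,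
      ih h₁ (by omega) (by omega), ih h₂ (by omega) (by omega)⟩

/-- The weight bound: a winning state has total weight at most `2 ^ j`. -/
theorem W.weight_le {j a b : ℕ} (h : W j a b) : (j + 1) * a + b ≤ 2 ^ j := by
  induction j generalizing a b with
  | zero => simp only [W] at h; omega
  | succ j ih =>
    obtain ⟨a₁, a₂, b₁, b₂, rfl, rfl, h₁, h₂⟩ := h
    have := ih h₁
    have := ih h₂
    rw [pow_succ]
    linarith

theorem W.zero_left {j b : ℕ} (h : b ≤ 2 ^ j) : W j 0 b := by
  induction j generalizing b with
  | zero => simpa [W] using h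
  | succ j ih =>
    rw [pow_succ] at h
    exact ⟨0, 0, b / 2, b - b / 2, rfl, by omega, ih (by omega), ih (by omega)⟩

theorem W.double {j a b : ℕ} (h : W j a (b + a)) : W (j + 1) (2 * a) (2 * b) :=
  ⟨a, a, b, b, by omega, by omega, h, h⟩

theorem W.two_pow_mul {j a b : ℕ} (k : ℕ) (h : W j a (b + k * a)) :
    W (j + k) (2 ^ k * a) (2 ^ k * b) := by
  induction k generalizing b with
  | zero => simpa using h
  | succ k ih =>
    have h' : W (j + k) (2 ^ k * a) (2 ^ k * b + 2 ^ k * a) := by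
      rw [← mul_add]
      exact ih (h.mono le_rfl (by linarith))
    simpa only [pow_succ', mul_assoc, add_assoc] using h'.double

/-- Separating the only consistent candidate from `b₂` of the once-lied ones. -/
theorem W.one_left {j b₁ b₂ : ℕ} (h : W j 1 b₁) (hb : b₂ + 1 ≤ 2 ^ j) :
    W (j + 1) 1 (b₁ + b₂) :=
  ⟨1, 0, b₁, b₂, rfl, rfl, h, W.zero_left hb⟩

theorem W.one_zero (j : ℕ) : W j 1 0 := by
  induction j with
  | zero => simp [W]
  | succ j ih => exact ih.one_left (b₂ := 0) Nat.one_le_two_pow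

theorem ulam_million : W 25 (10 ^ 6) 0 ∧ ¬ W 24 (10 ^ 6) 0 := by
  constructor
  · have h₄ : W 4 1 5 := (W.one_zero 3).one_left (b₂ := 5) (by norm_num)
    have h₅ : W 5 1 20 := h₄.one_left (b₂ := 15) (by norm_num)
    exact (W.two_pow_mul (b := 0) 20 h₅).mono (by norm_num) (by norm_num)
  · intro h
    have := h.weight_le
    norm_num at this
end
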